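/- arXiv:1501.02933 — 4 statements merged into one kernel-verified Lean document; each statement's English description precedes it below -/
import Mathlib

section
/- The number of m-tuples of 2×2 matrices over F_q generating a 3-dimensional (Borel-type) subalgebra of M_2, i.e. |Rep_2(m)_B(F_q)|, equals q^{m+1}(q^{m-1} - 1)(q^m - 1)(q + 1) (the n = 2 case of the formula (q^m - q)^{n-1}∏_{k=0}^{n-1}(q^m - k)∏_{k=1}^{n}(q^k-1)·q^{m(n-1)(n-2)/2}/(q-1)^n). -/
namespace Stmt12

variable {F : Type*} [Field F]

/-- Matrices for which the line indexed by `o` is invariant. -/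
def Bor (F : Type*) [Field F] : Option F → Submodule F (Matrix (Fin 2) (Fin 2) F)
  | some t =>
    { carrier := {A | A 1 0 + t * A 1 1 = t * A 0 0 + t ^ 2 * A 0 1}
      add_mem' := by
        intro a b ha hb
        simp only [Set.mem_ofPred_eq, Matrix.add_apply] at *
        linear_combination ha + hb
      zero_mem' := by simp
      smul_mem' := by
        intro c a ha
        simp only [Set.mem_ofPred_eq, Matrix.smul_apply, smul_eq_mul] at *
        linear_combination c * ha }
  | none =>
    { carrier := {A | A 0 1 = 0}
      add_mem' := by
        intro a b ha hb
        simp only [Set.mem_ofPred_eq, Matrix.add_apply] at *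
        linear_combination ha + hb
      zero_mem' := by simp
      smul_mem' := by
        intro c a ha
        simp only [Set.mem_ofPred_eq, Matrix.smul_apply, smul_eq_mul] at *
        linear_combination c * ha }

lemma mem_some (t : F) (A : Matrix (Fin 2) (Fin 2) F) :
    A ∈ Bor F (some t) ↔ A 1 0 + t * A 1 1 = t * A 0 0 + t ^ 2 * A 0 1 := Iff.rfl

lemma mem_none (A : Matrix (Fin 2) (Fin 2) F) :
    A ∈ Bor F none ↔ A 0 1 = 0 := Iff.rfl

/-- Parametrization. -/
def par : Option F → F → F → F → Matrix (Fin 2) (Fin 2) F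
  | some t, c, d, b => !![c + d - t * b, b; t * d - t ^ 2 * b, c + t * b]
  | none, c, d, b => !![c, 0; b, c + d]

lemma par_mem (o : Option F) (c d b : F) : par o c d b ∈ Bor F o := by
  cases o with
  | none => simp [mem_none, par]
  | some t => simp [mem_some, par]; ring

lemma par_surj (o : Option F) (A : Matrix (Fin 2) (Fin 2) F) (h : A ∈ Bor F o) :
    ∃ c d b, par o c d b = A := by
  cases o with
  | none =>
    rw [mem_none] at h
    refine ⟨A 0 0, A 1 1 - A 0 0, A 1 0, ?_⟩
    ext i j; fin_cases i <;> fin_cases j <;> simp [par, h]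
  | some t =>
    rw [mem_some] at h
    refine ⟨A 1 1 - t * A 0 1, A 0 0 - A 1 1 + 2 * t * A 0 1, A 0 1, ?_⟩
    ext i j; fin_cases i <;> fin_cases j <;> simp [par]
    · ring
    · linear_combination -h

lemma par_inj (o : Option F) {c d b c' d' b' : F} (h : par o c d b = par o c' d' b') :
    c = c' ∧ d = d' ∧ b = b' := by
  have h00 := congrFun (congrFun h 0) 0
  have h01 := congrFun (congrFun h 0) 1
  have h10 := congrFun (congrFun h 1) 0
  have h11 := congrFun (congrFun h 1) 1
  cases o with
  | none =>
    simp [par] at h00 h01 h10 h11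
    subst h00
    refine ⟨rfl, ?_, h10⟩
    linear_combination h11
  | some t =>
    simp [par] at h00 h01 h10 h11
    subst h01
    have : c = c' := by linear_combination h11
    subst this
    exact ⟨rfl, by linear_combination h00, rfl⟩

lemma par_comm (o : Option F) (c d b c' d' b' : F) :
    par o c d b * par o c' d' b' = par o c' d' b' * par o c d b ↔ d * b' = d' * b := by
  cases o with
  | none =>
    constructor
    · intro h
      have h10 := congrFun (congrFun h 1) 0
      simp [par, Matrix.mul_apply, Fin.sum_univ_two] at h10
      linear_combination h10
    · intro h
      ext i j; fin_cases i <;> fin_cases j <;> simp [par, Matrix.mul_apply, Fin.sum_univ_two]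
      · ring
      · linear_combination h
      · ring
  | some t =>
    constructor
    · intro h
      have h01 := congrFun (congrFun h 0) 1
      simp [par, Matrix.mul_apply, Fin.sum_univ_two] at h01
      linear_combination h01
    · intro h
      ext i j; fin_cases i <;> fin_cases j <;> simp [par, Matrix.mul_apply, Fin.sum_univ_two]
      · linear_combination (-t) * h
      · linear_combination h
      · linear_combination (-t ^ 2) * h
      · linear_combination t * h

lemma comm_none_some (t : F) (A B : Matrix (Fin 2) (Fin 2) F)
    (hA : A ∈ Bor F none) (hA' : A ∈ Bor F (some t))
    (hB : B ∈ Bor F none) (hB' : B ∈ Bor F (some t)) : A * B = B * A := by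
  rw [mem_none] at hA hB
  rw [mem_some] at hA' hB'
  rw [hA] at hA'
  rw [hB] at hB'
  have ha : A 1 0 = t * (A 0 0 - A 1 1) := by linear_combination hA'
  have hb : B 1 0 = t * (B 0 0 - B 1 1) := by linear_combination hB'
  ext i j; fin_cases i <;> fin_cases j <;>
    simp [Matrix.mul_apply, Fin.sum_univ_two, hA, hB, ha, hb] <;> ring

lemma comm_some_some (t s : F) (hts : t ≠ s) (A B : Matrix (Fin 2) (Fin 2) F)
    (hA : A ∈ Bor F (some s)) (hA' : A ∈ Bor F (some t))
    (hB : B ∈ Bor F (some s)) (hB' : B ∈ Bor F (some t)) : A * B = B * A := by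
  rw [mem_some] at hA hB hA' hB'
  have key : ∀ A : Matrix (Fin 2) (Fin 2) F, A 1 0 + s * A 1 1 = s * A 0 0 + s ^ 2 * A 0 1 →
      A 1 0 + t * A 1 1 = t * A 0 0 + t ^ 2 * A 0 1 →
      A 0 0 = A 1 1 - (t + s) * A 0 1 ∧ A 1 0 = - t * s * A 0 1 := by
    intro A h1 h2
    have h0 : A 0 0 = A 1 1 - (t + s) * A 0 1 := by
      apply mul_left_cancel₀ (sub_ne_zero.2 hts)
      linear_combination h1 - h2
    refine ⟨h0, ?_⟩
    rw [h0] at h1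
    linear_combination h1
  obtain ⟨a1, a2⟩ := key A hA hA'
  obtain ⟨b1, b2⟩ := key B hB hB'
  ext i j; fin_cases i <;> fin_cases j <;>
    simp [Matrix.mul_apply, Fin.sum_univ_two, a1, a2, b1, b2] <;> ring

lemma line_unique (o o' : Option F) (A B : Matrix (Fin 2) (Fin 2) F) (h : A * B ≠ B * A)
    (hA : A ∈ Bor F o) (hA' : A ∈ Bor F o')
    (hB : B ∈ Bor F o) (hB' : B ∈ Bor F o') : o = o' := by
  by_contra hne
  apply h
  cases o with
  | none =>
    cases o' with
    | none => exact absurd rfl hne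
    | some t => exact comm_none_some t A B hA hA' hB hB'
  | some s =>
    cases o' with
    | none => exact comm_none_some s A B hA' hA hB' hB
    | some t => exact comm_some_some t s (fun h => hne (by rw [h])) A B hA hA' hB hB'

lemma finrank_Bor_le (o : Option F) : Module.finrank F (Bor F o) ≤ 3 := by
  have h4 : Module.finrank F (Matrix (Fin 2) (Fin 2) F) = 4 := by
    simp [Module.finrank_matrix]
  have : Bor F o ≠ ⊤ := by
    intro h
    cases o with
    | none =>
      have : (!![0, 1; 0, 0] : Matrix (Fin 2) (Fin 2) F) ∈ Bor F none := by rw [h]; trivial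
      simp [mem_none] at this
    | some t =>
      have : (!![0, 0; 1, 0] : Matrix (Fin 2) (Fin 2) F) ∈ Bor F (some t) := by rw [h]; trivial
      simp [mem_some] at this
  have := Submodule.finrank_lt (lt_top_iff_ne_top.2 this).ne
  omega

lemma one_mem_Bor (o : Option F) : (1 : Matrix (Fin 2) (Fin 2) F) ∈ Bor F o := by
  cases o <;> simp [mem_none, mem_some]

lemma mul_mem_Bor (o : Option F) {A B : Matrix (Fin 2) (Fin 2) F}
    (hA : A ∈ Bor F o) (hB : B ∈ Bor F o) : A * B ∈ Bor F o := by
  cases o with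
  | none =>
    rw [mem_none] at *
    simp [Matrix.mul_apply, Fin.sum_univ_two, hA, hB]
  | some t =>
    rw [mem_some] at *
    simp only [Matrix.mul_apply, Fin.sum_univ_two]
    linear_combination (B 0 0 + t * B 0 1) * hA + (A 1 1 - t * A 0 1) * hB

/-- The stabilizer as a subalgebra. -/
def BorAlg (o : Option F) : Subalgebra F (Matrix (Fin 2) (Fin 2) F) :=
  (Bor F o).toSubalgebra (one_mem_Bor o) (fun _ _ h h' => mul_mem_Bor o h h')

lemma exists_line (S : Subalgebra F (Matrix (Fin 2) (Fin 2) F)) (hS : Module.finrank F S = 3) :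
    ∃ o, Subalgebra.toSubmodule S ≤ Bor F o := by
  have h4 : Module.finrank F (Matrix (Fin 2) (Fin 2) F) = 4 := by
    simp [Module.finrank_matrix]
  have hS' : Module.finrank F (Subalgebra.toSubmodule S) = 3 := hS
  have hlt : Subalgebra.toSubmodule S < ⊤ := by
    rw [lt_top_iff_ne_top]
    intro h
    rw [h, finrank_top] at hS'
    omega
  obtain ⟨f, hf0, hf⟩ := Submodule.exists_le_ker_of_lt_top _ hlt
  have hker : LinearMap.ker f ≠ ⊤ := fun h => hf0 (LinearMap.ker_eq_top.1 h)
  have h3 := Submodule.finrank_lt hker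
  have heq := Submodule.eq_of_le_of_finrank_le hf (by omega)
  obtain ⟨Y0, hY0⟩ : ∃ Y, f Y ≠ 0 := by
    by_contra! h
    exact hf0 (LinearMap.ext h)
  have hmul : ∀ X ∈ S, ∃ μ : F, ∀ Y, f (Y * X) = μ * f Y := by
    intro X hX
    refine ⟨f (Y0 * X) / f Y0, fun Y => ?_⟩
    have hm : Y - (f Y / f Y0) • Y0 ∈ Subalgebra.toSubmodule S := by
      rw [heq, LinearMap.mem_ker, map_sub, map_smul, smul_eq_mul]
      field_simp
      simp
    have hm2 : (Y - (f Y / f Y0) • Y0) * X ∈ Subalgebra.toSubmodule S := S.mul_mem hm hX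
    rw [heq, LinearMap.mem_ker, sub_mul, map_sub, smul_mul_assoc, map_smul, smul_eq_mul] at hm2
    field_simp at hm2 ⊢
    linear_combination hm2
  obtain ⟨i, hi⟩ : ∃ i, ¬ (f (Matrix.single i 0 1) = 0 ∧ f (Matrix.single i 1 1) = 0) := by
    by_contra! h
    apply hf0
    apply LinearMap.ext
    intro Y
    have e : Y = ∑ i, ∑ j, Y i j • Matrix.single i j (1 : F) := by
      conv_lhs => rw [Matrix.matrix_eq_sum_single Y]
      simp
    rw [e]
    simp only [Fin.sum_univ_two, map_add, map_smul, (h _).1, (h _).2, smul_zero, add_zero,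
      LinearMap.zero_apply]
  set x := f (Matrix.single i 0 1) with hx
  set y := f (Matrix.single i 1 1) with hy
  have hrow : ∀ (X : Matrix (Fin 2) (Fin 2) F) (j : Fin 2),
      f (Matrix.single i j 1 * X) = X j 0 * x + X j 1 * y := by
    intro X j
    have : Matrix.single i j 1 * X
        = X j 0 • Matrix.single i 0 (1 : F) + X j 1 • Matrix.single i 1 (1 : F) := by
      ext a b
      by_cases ha : a = i
      · subst ha
        fin_cases b <;> simp [Matrix.single_apply]
      · simp [Matrix.single_apply, ha, Ne.symm ha, Matrix.mul_apply, eq_comm]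
    rw [this, map_add, map_smul, map_smul, smul_eq_mul, smul_eq_mul]
  have heig : ∀ X ∈ S, ∃ μ : F, X 0 0 * x + X 0 1 * y = μ * x ∧ X 1 0 * x + X 1 1 * y = μ * y := by
    intro X hX
    obtain ⟨μ, hμ⟩ := hmul X hX
    exact ⟨μ, by rw [← hrow, hμ], by rw [← hrow, hμ]⟩
  by_cases hx0 : x = 0
  · have hy0 : y ≠ 0 := fun h => hi ⟨hx0, h⟩
    refine ⟨none, fun X hX => ?_⟩
    obtain ⟨μ, h1, h2⟩ := heig X hX
    rw [mem_none]
    rw [hx0] at h1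
    simpa [hy0] using h1
  · refine ⟨some (y / x), fun X hX => ?_⟩
    obtain ⟨μ, h1, h2⟩ := heig X hX
    rw [mem_some]
    field_simp
    linear_combination x * h2 - y * h1

lemma char_iff {m : ℕ} (A : Fin m → Matrix (Fin 2) (Fin 2) F) :
    Module.finrank F (Algebra.adjoin F (Set.range A)) = 3 ↔
      (∃ o, ∀ i, A i ∈ Bor F o) ∧ ∃ i j, A i * A j ≠ A j * A i := by
  constructor
  · intro h
    obtain ⟨o, ho⟩ := exists_line _ h
    refine ⟨⟨o, fun i => ho (Algebra.subset_adjoin ⟨i, rfl⟩)⟩, ?_⟩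
    by_contra! hc
    have heq := Submodule.eq_of_le_of_finrank_le ho ((finrank_Bor_le o).trans h.ge)
    have hcomm := Algebra.isMulCommutative_adjoin (R := F) (s := Set.range A) (by
      rintro _ ⟨i, rfl⟩ _ ⟨j, rfl⟩
      exact hc i j)
    have h1 : par o 0 1 0 ∈ Algebra.adjoin F (Set.range A) := by
      rw [← Subalgebra.mem_toSubmodule, heq]; exact par_mem _ _ _ _
    have h2 : par o 0 0 1 ∈ Algebra.adjoin F (Set.range A) := by
      rw [← Subalgebra.mem_toSubmodule, heq]; exact par_mem _ _ _ _
    have h3 := congrArg Subtype.val (hcomm.is_comm.comm ⟨_, h1⟩ ⟨_, h2⟩)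
    have h4 := (par_comm o 0 1 0 0 0 1).1 h3
    simp at h4
  · rintro ⟨⟨o, ho⟩, i, j, hij⟩
    apply le_antisymm
    · have hle : Algebra.adjoin F (Set.range A) ≤ BorAlg o := by
        rw [Algebra.adjoin_le_iff]
        rintro _ ⟨i, rfl⟩
        exact ho i
      have hle' : Subalgebra.toSubmodule (Algebra.adjoin F (Set.range A)) ≤ Bor F o := hle
      exact (Submodule.finrank_mono hle').trans (finrank_Bor_le o)
    · have hi : A i ∈ Algebra.adjoin F (Set.range A) := Algebra.subset_adjoin ⟨i, rfl⟩
      have hj : A j ∈ Algebra.adjoin F (Set.range A) := Algebra.subset_adjoin ⟨j, rfl⟩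
      have hli : LinearIndependent F
          (![1, ⟨A i, hi⟩, ⟨A j, hj⟩] : Fin 3 → Algebra.adjoin F (Set.range A)) := by
        rw [Fintype.linearIndependent_iff]
        intro g hg
        have hg' := congrArg Subtype.val hg
        simp [Fin.sum_univ_three] at hg'
        have e1 : g 1 • (A i * A j - A j * A i) = 0 := by
          have a1 := congrArg (fun M => M * A j - A j * M) hg'
          simp [add_mul, mul_add] at a1
          rw [smul_sub, ← a1]
        have e2 : g 2 • (A i * A j - A j * A i) = 0 := by
          have a1 := congrArg (fun M => A i * M - M * A i) hg'
          simp [add_mul, mul_add] at a1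
          rw [smul_sub, ← a1]
        have hne := sub_ne_zero.2 hij
        have g1 := (smul_eq_zero.1 e1).resolve_right hne
        have g2 := (smul_eq_zero.1 e2).resolve_right hne
        have g0 : g 0 = 0 := by simpa [g1, g2] using hg'
        intro k
        fin_cases k
        · exact g0
        · exact g1
        · exact g2
      simpa using hli.fintype_card_le_finrank

lemma li_iff {m : ℕ} (s : Fin 2 → Fin m → F) :
    LinearIndependent F s ↔ ∃ i j, s 0 i * s 1 j ≠ s 0 j * s 1 i := by
  have hs : s = ![s 0, s 1] := by
    ext k; fin_cases k <;> rfl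
  rw [hs, LinearIndependent.pair_iff]
  simp only [Matrix.cons_val_zero, Matrix.cons_val_one]
  constructor
  · intro h
    by_contra! hc
    by_cases h0 : s 0 = 0
    · have := (h 1 0 (by simp [h0])).1
      exact one_ne_zero this
    · obtain ⟨i, hi⟩ := Function.ne_iff.1 h0
      have := (h (s 1 i) (- s 0 i) (by
        ext j
        simp
        linear_combination -(hc i j))).2
      exact hi (by simpa using this)
  · rintro ⟨i, j, hij⟩ a b hab
    have hi := congrFun hab i
    have hj := congrFun hab j
    simp at hi hj
    have hne := sub_ne_zero.2 hij
    constructor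
    · apply (mul_eq_zero.1 (?_ : a * (s 0 i * s 1 j - s 0 j * s 1 i) = 0)).resolve_right hne
      linear_combination s 1 j * hi - s 1 i * hj
    · apply (mul_eq_zero.1 (?_ : b * (s 0 i * s 1 j - s 0 j * s 1 i) = 0)).resolve_right hne
      linear_combination s 0 i * hj - s 0 j * hi

/-- The parametrizing map. -/
def Phi (F : Type*) [Field F] (m : ℕ) :
    Option F × (Fin m → F) × {s : Fin 2 → Fin m → F // LinearIndependent F s} →
    {A : Fin m → Matrix (Fin 2) (Fin 2) F //
      Module.finrank F (Algebra.adjoin F (Set.range A)) = 3} :=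
  fun x => ⟨fun i => par x.1 (x.2.1 i) (x.2.2.1 0 i) (x.2.2.1 1 i), by
    rw [char_iff]
    refine ⟨⟨x.1, fun i => par_mem _ _ _ _⟩, ?_⟩
    obtain ⟨i, j, h⟩ := (li_iff _).1 x.2.2.2
    exact ⟨i, j, fun h' => h ((par_comm _ _ _ _ _ _ _).1 h')⟩⟩

lemma Phi_bij (m : ℕ) : Function.Bijective (Phi F m) := by
  constructor
  · rintro ⟨o, c, s, hs⟩ ⟨o', c', s', hs'⟩ h
    have hA : ∀ i, par o (c i) (s 0 i) (s 1 i) = par o' (c' i) (s' 0 i) (s' 1 i) :=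
      fun i => congrFun (congrArg Subtype.val h) i
    obtain ⟨i, j, hij⟩ := (li_iff _).1 hs
    have ho : o = o' := by
      refine line_unique o o' _ _ (fun h' => hij ((par_comm o (c i) _ _ (c j) _ _).1 h'))
        (par_mem _ _ _ _) ?_ (par_mem _ _ _ _) ?_
      · rw [hA]; exact par_mem _ _ _ _
      · rw [hA]; exact par_mem _ _ _ _
    subst ho
    have hc : c = c' := funext fun i => (par_inj o (hA i)).1
    have hss : s = s' := by
      ext k i
      fin_cases k
      · exact (par_inj o (hA i)).2.1
      · exact (par_inj o (hA i)).2.2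
    subst hc hss
    rfl
  · rintro ⟨A, hA⟩
    obtain ⟨⟨o, ho⟩, i, j, hij⟩ := (char_iff A).1 hA
    choose c d b h using fun i => par_surj o (A i) (ho i)
    refine ⟨⟨o, c, ![d, b], ?_⟩, ?_⟩
    · rw [li_iff]
      refine ⟨i, j, fun h' => hij ?_⟩
      rw [← h i, ← h j, par_comm]
      exact h'
    · apply Subtype.ext
      funext i
      exact h i

end Stmt12

/-- the number of `m`-tuples of `2 × 2` matrices over `F_q` generating a
3-dimensional (Borel-type) subalgebra of `M₂` is `q^{m+1}(q^{m-1}-1)(q^m-1)(q+1)`. -/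
theorem stmt_12 (Fq : Type*) [Field Fq] [Fintype Fq] (q m : ℕ) (hm : 1 ≤ m)
    (hq : Fintype.card Fq = q) :
    Nat.card {A : Fin m → Matrix (Fin 2) (Fin 2) Fq //
        Module.finrank Fq
          (Algebra.adjoin Fq (Set.range A) : Subalgebra Fq (Matrix (Fin 2) (Fin 2) Fq)) = 3}
      = q ^ (m + 1) * (q ^ (m - 1) - 1) * (q ^ m - 1) * (q + 1) := by
  rw [← Nat.card_congr (Equiv.ofBijective _ (Stmt12.Phi_bij (F := Fq) m))]
  rw [Nat.card_prod, Nat.card_prod]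
  have h1 : Nat.card (Option Fq) = q + 1 := by
    rw [Nat.card_eq_fintype_card, Fintype.card_option, hq]
  have h2 : Nat.card (Fin m → Fq) = q ^ m := by
    rw [Nat.card_eq_fintype_card]; simp [hq]
  have h3 : Nat.card {s : Fin 2 → Fin m → Fq // LinearIndependent Fq s}
      = (q ^ m - 1) * (q * (q ^ (m - 1) - 1)) := by
    rcases Nat.lt_or_ge m 2 with h | h
    · have : m = 1 := by omega
      subst this
      have : IsEmpty {s : Fin 2 → Fin 1 → Fq // LinearIndependent Fq s} := by
        refine ⟨fun s => ?_⟩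
        have := s.2.fintype_card_le_finrank
        simp at this
      simp
    · have := card_linearIndependent (K := Fq) (V := Fin m → Fq) (k := 2) (by simpa using h)
      rw [this]
      have e : q ^ m = q * q ^ (m - 1) := by
        rw [← pow_succ']; congr 1; omega
      simp [Fin.prod_univ_two, hq, Nat.mul_sub, ← e]
  rw [h1, h2, h3]
  ring
end

section
/- The number of m-tuples (A_1,...,A_m) of 2×2 matrices over F_q that generate the full matrix algebra M_2(F_q) (absolutely irreducible representations of degree 2 of the free monoid with m generators over F_q) equals q^{2m+1}(q^m - 1)(q^{m-1} - 1). -/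
namespace Stmt13

open Matrix

variable {F : Type*} [Field F]

open Classical in
/-- parametrisation of the bad upper right corners -/
noncomputable def g {m : ℕ} (c e : Fin m → F) (x : F) : Fin m → F :=
  if e ∈ Submodule.span F {c} then x • c else (x ^ 2) • c - x • e

lemma g_inj {m : ℕ} (c e : Fin m → F) (hc : c ≠ 0) : Function.Injective (g c e) := by
  intro x y h
  unfold g at h
  split_ifs at h with he
  · exact smul_left_injective F hc h
  · by_contra hxy
    apply he
    rw [Submodule.mem_span_singleton]
    refine ⟨x + y, ?_⟩
    have hs : x - y ≠ 0 := sub_ne_zero.2 hxy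
    apply smul_right_injective _ hs
    ext i
    have := congrFun h i
    simp only [Pi.sub_apply, Pi.smul_apply, smul_eq_mul] at this ⊢
    linear_combination this

abbrev M2 (F : Type*) := Matrix (Fin 2) (Fin 2) F

/-- assemble the tuple from its coordinates -/
def mk {m : ℕ} (d c e b : Fin m → F) : Fin m → M2 F :=
  fun i => !![e i + d i, b i; c i, d i]

lemma top_of_E01 (S : Subalgebra F (M2 F)) (hE : !![0, 1; 0, 0] ∈ S)
    (A : M2 F) (hA : A ∈ S) (hc : A 1 0 ≠ 0) : S = ⊤ := by
  obtain ⟨a, b, c, d, rfl⟩ : ∃ a b c d, A = !![a, b; c, d] := ⟨_, _, _, _, Matrix.eta_fin_two A⟩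
  replace hc : c ≠ 0 := hc
  have h00 : (!![1, 0; 0, 0] : M2 F) ∈ S := by
    have : (!![1, 0; 0, 0] : M2 F) = c⁻¹ • (!![0, 1; 0, 0] * !![a, b; c, d] - d • !![0, 1; 0, 0]) := by
      ext i j; fin_cases i <;> fin_cases j <;> simp [Matrix.mul_apply, Fin.sum_univ_two, hc]
    rw [this]
    exact S.smul_mem (S.sub_mem (S.mul_mem hE hA) (S.smul_mem hE _)) _
  have h11 : (!![0, 0; 0, 1] : M2 F) ∈ S := by
    have : (!![0, 0; 0, 1] : M2 F) = 1 - !![1, 0; 0, 0] := by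
      ext i j; fin_cases i <;> fin_cases j <;> simp
    rw [this]
    exact S.sub_mem S.one_mem h00
  have h10 : (!![0, 0; 1, 0] : M2 F) ∈ S := by
    have : (!![0, 0; 1, 0] : M2 F) = c⁻¹ • (!![0, 0; 0, 1] * !![a, b; c, d] * !![1, 0; 0, 0]) := by
      ext i j; fin_cases i <;> fin_cases j <;> simp [Matrix.mul_apply, Fin.sum_univ_two, hc]
    rw [this]
    exact S.smul_mem (S.mul_mem (S.mul_mem h11 hA) h00) _
  rw [eq_top_iff]
  intro B _
  have : B = B 0 0 • !![1, 0; 0, 0] + B 0 1 • !![0, 1; 0, 0] + B 1 0 • !![0, 0; 1, 0]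
      + B 1 1 • !![0, 0; 0, 1] := by
    ext i j; fin_cases i <;> fin_cases j <;> simp
  rw [this]
  exact S.add_mem (S.add_mem (S.add_mem (S.smul_mem h00 _) (S.smul_mem hE _))
    (S.smul_mem h10 _)) (S.smul_mem h11 _)

lemma comb {m : ℕ} (d c e b : Fin m → F) (f : (Fin m → F) →ₗ[F] F) :
    (!![f e, f b; f c, 0] : M2 F) ∈ Algebra.adjoin F (Set.range (mk d c e b)) := by
  set S := Algebra.adjoin F (Set.range (mk d c e b))
  have h1 : (∑ i, f (Pi.single i 1) • mk d c e b i) - f d • 1 ∈ S := by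
    refine S.sub_mem (S.sum_mem fun i _ => S.smul_mem (Algebra.subset_adjoin ⟨i, rfl⟩) _)
      (S.smul_mem S.one_mem _)
  have key : ∀ v : Fin m → F, f v = ∑ i, f (Pi.single i 1) * v i := by
    intro v
    rw [LinearMap.pi_apply_eq_sum_univ f v]
    refine Finset.sum_congr rfl fun i _ => ?_
    rw [smul_eq_mul, mul_comm]
    congr 2
    ext j
    simp [Pi.single_apply, eq_comm]
  convert h1 using 1
  ext i j
  fin_cases i <;> fin_cases j <;>
    simp [mk, Matrix.sum_apply, key e, key b, key c, key d, mul_add, Finset.sum_add_distrib]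

lemma exists_dual {m : ℕ} (p : Submodule F (Fin m → F)) (v : Fin m → F) (hv : v ∉ p) :
    ∃ f : (Fin m → F) →ₗ[F] F, f v = 1 ∧ ∀ w ∈ p, f w = 0 := by
  obtain ⟨f, hf, hp⟩ := Submodule.exists_le_ker_of_notMem hv
  refine ⟨(f v)⁻¹ • f, by simp [hf], fun w hw => ?_⟩
  have : f w = 0 := hp hw
  simp [this]

lemma good_top {m : ℕ} (d c e b : Fin m → F) (hc : c ≠ 0) (hb : b ∉ Set.range (g c e)) :
    Algebra.adjoin F (Set.range (mk d c e b)) = ⊤ := by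
  have hE : (!![0, 1; 0, 0] : M2 F) ∈ Algebra.adjoin F (Set.range (mk d c e b)) := by
    by_cases hbs : b ∈ Submodule.span F {c, e}
    · by_cases he : e ∈ Submodule.span F {c}
      · exfalso
        obtain ⟨l, rfl⟩ := Submodule.mem_span_singleton.1 he
        obtain ⟨x, y, rfl⟩ := Submodule.mem_span_pair.1 hbs
        apply hb
        refine ⟨x + y * l, ?_⟩
        simp only [g, he, if_true]
        rw [add_smul, mul_smul]
      · obtain ⟨x, y, rfl⟩ := Submodule.mem_span_pair.1 hbs
        have hxy : x - y ^ 2 ≠ 0 := by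
          intro h
          apply hb
          refine ⟨-y, ?_⟩
          simp only [g, he, if_false]
          rw [sub_eq_zero.1 h]
          simp
        have hc' : c ∉ Submodule.span F {e} := by
          intro h
          obtain ⟨l, rfl⟩ := Submodule.mem_span_singleton.1 h
          have hl : l ≠ 0 := by rintro rfl; simp at hc
          exact he (Submodule.mem_span_singleton.2 ⟨l⁻¹, by rw [smul_smul, inv_mul_cancel₀ hl, one_smul]⟩)
        obtain ⟨f, hf1, hf0⟩ := exists_dual _ _ he
        obtain ⟨k, hk1, hk0⟩ := exists_dual _ _ hc'
        have hfc := hf0 c (Submodule.mem_span_singleton_self c)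
        have hke := hk0 e (Submodule.mem_span_singleton_self e)
        have h1 := comb d c e (x • c + y • e) f
        have h2 := comb d c e (x • c + y • e) k
        simp only [map_add, map_smul, hf1, hfc, hk1, hke, smul_eq_mul, mul_zero, mul_one, zero_add,
          add_zero] at h1 h2
        have : (!![0, 1; 0, 0] : M2 F) = (x - y ^ 2)⁻¹ •
            (!![1, y; 0, 0] * !![0, x; 1, 0] - y • !![1, y; 0, 0]) := by
          ext i j
          fin_cases i <;> fin_cases j <;> simp [Matrix.mul_apply, Fin.sum_univ_two]
          rw [← pow_two, inv_mul_cancel₀ hxy]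
        rw [this]
        exact Subalgebra.smul_mem _ (Subalgebra.sub_mem _ (Subalgebra.mul_mem _ h1 h2)
          (Subalgebra.smul_mem _ h1 _)) _
    · obtain ⟨f, hf1, hf0⟩ := exists_dual _ _ hbs
      have := comb d c e b f
      rwa [hf1, hf0 c (Submodule.subset_span (by simp)),
        hf0 e (Submodule.subset_span (by simp))] at this
  obtain ⟨i, hi⟩ := Function.ne_iff.1 hc
  exact top_of_E01 _ hE (mk d c e b i) (Algebra.subset_adjoin ⟨i, rfl⟩) (by simpa [mk] using hi)

/-- stabiliser of the line through `(x, y)` -/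
def stab (x y : F) (hxy : x ≠ 0 ∨ y ≠ 0) : Subalgebra F (M2 F) where
  carrier := {M | ∃ l, M 0 0 * x + M 0 1 * y = l * x ∧ M 1 0 * x + M 1 1 * y = l * y}
  mul_mem' := by
    rintro A B ⟨l, h1, h2⟩ ⟨k, h3, h4⟩
    refine ⟨l * k, ?_, ?_⟩ <;> simp only [Matrix.mul_apply, Fin.sum_univ_two]
    · linear_combination A 0 0 * h3 + A 0 1 * h4 + k * h1
    · linear_combination A 1 0 * h3 + A 1 1 * h4 + k * h2
  add_mem' := by
    rintro A B ⟨l, h1, h2⟩ ⟨k, h3, h4⟩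
    refine ⟨l + k, ?_, ?_⟩ <;> simp only [Matrix.add_apply]
    · linear_combination h1 + h3
    · linear_combination h2 + h4
  algebraMap_mem' := by
    intro r
    exact ⟨r, by simp [Matrix.algebraMap_matrix_apply], by simp [Matrix.algebraMap_matrix_apply]⟩

lemma stab_ne_top (x y : F) (hxy : x ≠ 0 ∨ y ≠ 0) : stab x y hxy ≠ ⊤ := by
  intro h
  have h1 : (!![0, 1; 0, 0] : M2 F) ∈ stab x y hxy := by rw [h]; trivial
  have h2 : (!![0, 0; 1, 0] : M2 F) ∈ stab x y hxy := by rw [h]; trivial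
  obtain ⟨l, h1, h1'⟩ := h1
  obtain ⟨k, h2, h2'⟩ := h2
  simp at h1 h1' h2 h2'
  grind

lemma top_good {m : ℕ} (d c e b : Fin m → F)
    (h : Algebra.adjoin F (Set.range (mk d c e b)) = ⊤) : c ≠ 0 ∧ b ∉ Set.range (g c e) := by
  have hst : ∀ x y hxy, ¬ (∀ i, mk d c e b i ∈ stab x y hxy) := by
    intro x y hxy hi
    apply stab_ne_top x y hxy
    rw [eq_top_iff, ← h]
    apply Algebra.adjoin_le
    rintro _ ⟨i, rfl⟩
    exact hi i
  have hc : c ≠ 0 := by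
    rintro rfl
    exact hst 1 0 (by simp) fun i => ⟨e i + d i, by simp [mk], by simp [mk]⟩
  refine ⟨hc, ?_⟩
  rintro ⟨x, hx⟩
  unfold g at hx
  split_ifs at hx with he
  · obtain ⟨l, rfl⟩ := Submodule.mem_span_singleton.1 he
    subst hx
    have hle : Algebra.adjoin F (Set.range (mk d c (l • c) (x • c))) ≤
        Subalgebra.centralizer F {(!![l, x; 1, 0] : M2 F)} := by
      apply Algebra.adjoin_le
      rintro _ ⟨i, rfl⟩
      simp only [SetLike.mem_coe, Subalgebra.mem_centralizer_iff, Set.mem_singleton_iff, forall_eq]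
      ext j k
      fin_cases j <;> fin_cases k <;> simp [mk, Matrix.mul_apply, Fin.sum_univ_two] <;> ring
    rw [h] at hle
    have h1 : (!![0, 1; 0, 0] : M2 F) ∈ Subalgebra.centralizer F {(!![l, x; 1, 0] : M2 F)} :=
      hle trivial
    simp only [Subalgebra.mem_centralizer_iff, Set.mem_singleton_iff, forall_eq] at h1
    have := congrFun (congrFun h1 0) 0
    simp [Matrix.mul_apply, Fin.sum_univ_two] at this
  · refine hst x 1 (by simp) fun i => ⟨x * c i + d i, ?_, ?_⟩
    · subst hx
      simp [mk]; ring
    · simp [mk]; ring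

lemma iff_good [Fintype F] {m : ℕ} (d c e b : Fin m → F) :
    Module.finrank F (Algebra.adjoin F (Set.range (mk d c e b)) : Subalgebra F (M2 F)) = 4 ↔
      c ≠ 0 ∧ b ∉ Set.range (g c e) := by
  have h4 : Module.finrank F (M2 F) = 4 := by simp [Module.finrank_matrix]
  constructor
  · intro h
    apply top_good d
    apply Subalgebra.toSubmodule_injective
    rw [Algebra.top_toSubmodule]
    apply Submodule.eq_top_of_finrank_eq
    rw [h4]; exact h
  · rintro ⟨h1, h2⟩
    rw [good_top d c e b h1 h2, ← h4]
    exact Subalgebra.topEquiv.toLinearEquiv.finrank_eq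

/-- coordinates -/
def coords (m : ℕ) : (Fin m → M2 F) ≃
    (Fin m → F) × (Σ _ : Fin m → F, Σ _ : Fin m → F, (Fin m → F)) where
  toFun A := (fun i => A i 1 1, ⟨fun i => A i 1 0, fun i => A i 0 0 - A i 1 1, fun i => A i 0 1⟩)
  invFun t := mk t.1 t.2.1 t.2.2.1 t.2.2.2
  left_inv A := by
    ext i j k
    fin_cases j <;> fin_cases k <;> simp [mk]
  right_inv := by
    rintro ⟨d, c, e, b⟩
    simp [mk]

/-- the generating tuples in coordinates -/
noncomputable def goodEquiv [Fintype F] (m : ℕ) :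
    {A : Fin m → M2 F // Module.finrank F
      (Algebra.adjoin F (Set.range A) : Subalgebra F (M2 F)) = 4} ≃
    (Fin m → F) × (Σ c : {c : Fin m → F // c ≠ 0}, Σ e : Fin m → F,
      {b : Fin m → F // b ∉ Set.range (g c.1 e)}) where
  toFun A :=
    have h := (iff_good (fun i => A.1 i 1 1) (fun i => A.1 i 1 0)
        (fun i => A.1 i 0 0 - A.1 i 1 1) (fun i => A.1 i 0 1)).1 (by
          have := A.2
          rwa [← (coords m).left_inv A.1] at this)
    (fun i => A.1 i 1 1, ⟨⟨fun i => A.1 i 1 0, h.1⟩, fun i => A.1 i 0 0 - A.1 i 1 1,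
      ⟨fun i => A.1 i 0 1, h.2⟩⟩)
  invFun t := ⟨mk t.1 t.2.1.1 t.2.2.1 t.2.2.2.1, (iff_good _ _ _ _).2 ⟨t.2.1.2, t.2.2.2.2⟩⟩
  left_inv A := Subtype.ext ((coords m).left_inv A.1)
  right_inv := by
    rintro ⟨d, ⟨c, hc⟩, e, ⟨b, hb⟩⟩
    have h1 : (fun i => mk d c e b i 0 0 - mk d c e b i 1 1) = e := by ext i; simp [mk]
    refine Prod.ext rfl ?_
    refine Sigma.ext rfl (heq_of_eq ?_)
    refine Sigma.ext h1 ?_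
    refine (Subtype.heq_iff_coe_eq ?_).2 rfl
    intro x
    exact iff_of_eq (congrArg (fun t => x ∉ Set.range (g c t)) h1)

lemma card_compl [Fintype F] {m : ℕ} (c e : Fin m → F) (hc : c ≠ 0) :
    Nat.card {b : Fin m → F // b ∉ Set.range (g c e)} =
      Fintype.card F ^ m - Fintype.card F := by
  classical
  have h1 := Set.ncard_compl (Set.range (g c e))
  rw [← Nat.card_coe_set_eq, ← Nat.card_coe_set_eq,
    Nat.card_range_of_injective (g_inj c e hc)] at h1
  refine Eq.trans h1 ?_
  simp

end Stmt13

/-- the number of `m`-tuples of `2 × 2` matrices over `F_q` generating the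
full matrix algebra `M₂(F_q)` (absolutely irreducible tuples) is `q^{2m+1}(q^m-1)(q^{m-1}-1)`. -/
theorem stmt_13 (Fq : Type*) [Field Fq] [Fintype Fq] (q m : ℕ) (hm : 1 ≤ m)
    (hq : Fintype.card Fq = q) :
    Nat.card {A : Fin m → Matrix (Fin 2) (Fin 2) Fq //
        Module.finrank Fq
          (Algebra.adjoin Fq (Set.range A) : Subalgebra Fq (Matrix (Fin 2) (Fin 2) Fq)) = 4}
      = q ^ (2 * m + 1) * (q ^ m - 1) * (q ^ (m - 1) - 1) := by
  classical
  rw [Nat.card_congr (Stmt13.goodEquiv m), Nat.card_prod, Nat.card_sigma]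
  have h1 : ∀ c : {c : Fin m → Fq // c ≠ 0}, Nat.card (Σ e : Fin m → Fq,
      {b : Fin m → Fq // b ∉ Set.range (Stmt13.g c.1 e)}) = q ^ m * (q ^ m - q) := by
    intro c
    rw [Nat.card_sigma]
    simp only [Stmt13.card_compl c.1 _ c.2]
    simp [hq]
  have h2 : Fintype.card {c : Fin m → Fq // c ≠ 0} = q ^ m - 1 := by
    rw [Fintype.card_subtype_compl]
    simp [hq]
  simp only [h1, Finset.sum_const, Finset.card_univ, h2, Nat.card_eq_fintype_card,
    Fintype.card_pi, hq, Finset.prod_const, Fintype.card_fin, smul_eq_mul]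
  have h3 : q ^ m - q = q * (q ^ (m - 1) - 1) := by
    obtain ⟨k, rfl⟩ := Nat.exists_eq_add_of_le' hm
    rw [Nat.mul_sub, Nat.add_sub_cancel, pow_succ, mul_one, mul_comm]
  rw [h3]
  ring
end

section
/- The number of simultaneous-conjugacy classes under PGL_2(F_q) of absolutely irreducible m-tuples of 2×2 matrices over F_q equals q^{2m}(q^m - 1)(q^{m-1} - 1)/(q^2 - 1); equivalently, since PGL_2(F_q) acts freely on the set of absolutely irreducible tuples, this is |Rep_2(m)_{air}(F_q)| / |PGL_2(F_q)|. -/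
section Aux
open Matrix
variable {F : Type*} [Field F] {m : ℕ}

def GoodT (a b c : Fin m → F) : Prop :=
  (LinearIndependent F ![b, c] ∧ ¬ ∃ l : Fˣ, a = (l : F) • b - ((l⁻¹ : Fˣ) : F) • c) ∨
  (LinearIndependent F ![b, a] ∧ ∃ l : Fˣ, c = (l : F) • b)

lemma adj_of_closed (A : Fin m → Matrix (Fin 2) (Fin 2) F) (p : Matrix (Fin 2) (Fin 2) F → Prop)
    (h0 : ∀ i, p (A i)) (h1 : ∀ r : F, p !![r, 0; 0, r]) (h2 : ∀ X Y, p X → p Y → p (X + Y))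
    (h3 : ∀ X Y, p X → p Y → p (X * Y)) (ht : Algebra.adjoin F (Set.range A) = ⊤) (X) : p X := by
  have hX : X ∈ Algebra.adjoin F (Set.range A) := by rw [ht]; trivial
  induction hX using Algebra.adjoin_induction with
  | mem x hx => obtain ⟨i, rfl⟩ := hx; exact h0 i
  | algebraMap r =>
    convert h1 r
    ext i j; fin_cases i <;> fin_cases j <;> simp [Matrix.algebraMap_matrix_apply]
  | add x y _ _ hx hy => exact h2 _ _ hx hy
  | mul x y _ _ hx hy => exact h3 _ _ hx hy

lemma good_of_top (A : Fin m → Matrix (Fin 2) (Fin 2) F)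
    (ht : Algebra.adjoin F (Set.range A) = ⊤) :
    GoodT (fun i => A i 0 0 - A i 1 1) (fun i => A i 0 1) (fun i => A i 1 0) := by
  have hb : (fun i => A i 0 1) ≠ 0 := by
    intro hb
    have := adj_of_closed A (fun X => X 0 1 = 0) (fun i => congrFun hb i) (by simp)
      (by intro X Y hX hY; simp [hX, hY]) 
      (by intro X Y hX hY; simp [hX, hY, Matrix.mul_apply]) ht !![0, 1; 0, 0]
    simp at this
  have hc : (fun i => A i 1 0) ≠ 0 := by
    intro hb
    have := adj_of_closed A (fun X => X 1 0 = 0) (fun i => congrFun hb i) (by simp)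
      (by intro X Y hX hY; simp [hX, hY]) 
      (by intro X Y hX hY; simp [hX, hY, Matrix.mul_apply]) ht !![0, 0; 1, 0]
    simp at this
  by_cases hi : LinearIndependent F ![(fun i => A i 0 1), (fun i => A i 1 0)]
  · left
    refine ⟨hi, ?_⟩
    rintro ⟨l, hl⟩
    have hl0 : (l : F) * ((l⁻¹ : Fˣ) : F) = 1 := by simp
    generalize ((l⁻¹ : Fˣ) : F) = k at *
    generalize (l : F) = l at *
    have := adj_of_closed A (fun X => X 0 0 - X 1 1 = l * X 0 1 - k * X 1 0)
      (fun i => by simpa using congrFun hl i) (by simp)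
      (by intro X Y hX hY; simp only [Matrix.add_apply]; linear_combination hX + hY) 
      (by
        intro X Y hX hY
        simp only [Matrix.mul_apply, Fin.sum_univ_two]
        linear_combination (X 0 0 + k * X 1 0) * hY + (Y 1 1 - k * Y 1 0) * hX + (X 1 0 * Y 0 1 - X 0 1 * Y 1 0) * hl0) ht !![1, 0; 0, 0]
    simp at this
  · right
    rw [LinearIndependent.pair_iff' hb] at hi
    push Not at hi
    obtain ⟨l, hl⟩ := hi
    have hl0 : l ≠ 0 := by rintro rfl; simp at hl; exact hc hl.symm
    refine ⟨?_, Units.mk0 l hl0, by simpa using hl.symm⟩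
    rw [LinearIndependent.pair_iff' hb]
    intro k hk
    have := adj_of_closed A (fun X => X 1 0 = l * X 0 1 ∧ X 0 0 - X 1 1 = k * X 0 1)
      (fun i => ⟨by simpa using (congrFun hl i).symm, by simpa using (congrFun hk i).symm⟩) (by simp)
      (by rintro X Y ⟨hX, hX'⟩ ⟨hY, hY'⟩; simp only [Matrix.add_apply]
          exact ⟨by linear_combination hX + hY, by linear_combination hX' + hY'⟩) 
      (by
        rintro X Y ⟨hX, hX'⟩ ⟨hY, hY'⟩
        simp only [Matrix.mul_apply, Fin.sum_univ_two]
        have e1 := eq_add_of_sub_eq hX'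
        have e2 := eq_add_of_sub_eq hY'
        rw [hX, hY, e1, e2]
        constructor <;> ring) ht !![1, 0; 0, 0]
    simp at this

lemma top_of_good (A : Fin m → Matrix (Fin 2) (Fin 2) F)
    (hg : GoodT (fun i => A i 0 0 - A i 1 1) (fun i => A i 0 1) (fun i => A i 1 0)) :
    Algebra.adjoin F (Set.range A) = ⊤ := by
  by_contra hne
  have hlt : Subalgebra.toSubmodule (Algebra.adjoin F (Set.range A)) < ⊤ := by
    rw [lt_top_iff_ne_top]
    intro h; apply hne
    rwa [Algebra.toSubmodule_eq_top] at h
  obtain ⟨f, hf0, hf⟩ := Submodule.exists_le_ker_of_lt_top _ hlt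
  obtain ⟨u, w, v, t, hft⟩ : ∃ u w v t, ∀ X, f X = u * X 0 0 + w * X 0 1 + v * X 1 0 + t * X 1 1 := by
    refine ⟨f (single 0 0 1), f (single 0 1 1), f (single 1 0 1), f (single 1 1 1), fun X => ?_⟩
    conv_lhs => rw [matrix_eq_sum_single X]
    have : ∀ i j, single i j (X i j) = X i j • single i j (1:F) := by intro i j; simp [smul_single]
    simp only [Fin.sum_univ_two, map_add, this, map_smul, smul_eq_mul]
    ring
  have hm : ∀ X ∈ Algebra.adjoin F (Set.range A), f X = 0 := fun X hX => hf hX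
  have h1 := hm 1 (one_mem _)
  have hA : ∀ i, A i ∈ Algebra.adjoin F (Set.range A) := fun i => Algebra.subset_adjoin ⟨i, rfl⟩
  have h2 := fun i => hm _ (hA i)
  have h3 := fun i j => hm _ (mul_mem (hA i) (hA j))
  simp only [hft, Matrix.mul_apply, Fin.sum_univ_two] at h1 h2 h3
  simp at h1
  obtain rfl : t = -u := by linear_combination h1
  have hz : ¬ (u = 0 ∧ w = 0 ∧ v = 0) := by
    rintro ⟨rfl, rfl, rfl⟩
    apply hf0; ext1; simp [hft]
  rcases hg with ⟨hi, hl⟩ | ⟨hi, l, hl⟩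
  · rw [LinearIndependent.pair_iff] at hi
    have hu : u ≠ 0 := by
      rintro rfl
      have := hi w v (by ext i; simpa using h2 i)
      exact hz ⟨rfl, this⟩
    have hmin : ∃ i j, A i 0 1 * A j 1 0 - A i 1 0 * A j 0 1 ≠ 0 := by
      by_contra! hh
      by_cases hb : ∀ i, A i 0 1 = 0
      · have := hi 1 0 (by ext i; simp [hb])
        simp at this
      · push Not at hb
        obtain ⟨i, hb⟩ := hb
        have := hi (- A i 1 0) (A i 0 1) (by ext j; simp; linear_combination hh i j)
        exact hb this.2
    obtain ⟨i, j, hij⟩ := hmin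
    have key : (u ^ 2 + v * w) * (A i 0 1 * A j 1 0 - A i 1 0 * A j 0 1) = 0 := by
      linear_combination u * h3 i j - (u * A j 0 0 + w * A j 0 1) * h2 i - (u * A i 1 1 - w * A i 0 1) * h2 j 
    have huv : u ^ 2 + v * w = 0 := by simpa [hij] using key
    have hw : w ≠ 0 := by rintro rfl; simp at huv; exact hu huv
    apply hl
    refine ⟨Units.mk0 (-w / u) (by simp [hu, hw]), ?_⟩
    ext i
    simp
    field_simp
    linear_combination w * h2 i - A i 1 0 * huv
  · rw [LinearIndependent.pair_iff] at hi
    have hl' := fun i => congrFun hl i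
    simp at hl'
    have := hi (w + v * l) u (by ext i; simp; linear_combination h2 i - v * hl' i)
    obtain ⟨hw, rfl⟩ := this
    have hv : v ≠ 0 := by
      rintro rfl; apply hz; simpa using hw
    have hh : ∀ i j, A i 0 1 * (A j 0 0 - A j 1 1) - (A i 0 0 - A i 1 1) * A j 0 1 = 0 := by
      intro i j
      have : v * l * (A i 0 1 * (A j 0 0 - A j 1 1) - (A i 0 0 - A i 1 1) * A j 0 1) = 0 := by
        have h := h3 i j
        have e : w = - (v * l) := by linear_combination hw
        subst e
        rw [hl', hl'] at h
        linear_combination h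
      simpa [hv] using this
    by_cases hb : ∀ i, A i 0 1 = 0
    · have := hi 1 0 (by ext i; simp [hb])
      simp at this
    · push Not at hb
      obtain ⟨i, hb⟩ := hb
      have := hi (- (A i 0 0 - A i 1 1)) (A i 0 1) (by ext j; simp; linear_combination hh i j)
      exact hb this.2

lemma top_iff_finrank (S : Subalgebra F (Matrix (Fin 2) (Fin 2) F)) :
    Module.finrank F S = 4 ↔ S = ⊤ := by
  have h4 : Module.finrank F (Matrix (Fin 2) (Fin 2) F) = 4 := by
    simp [Module.finrank_matrix]
  constructor
  · intro h
    rw [← Algebra.toSubmodule_eq_top]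
    apply Submodule.eq_top_of_finrank_eq
    rw [h4]; exact h
  · rintro rfl
    rw [← h4]
    exact (Subalgebra.topEquiv (R := F) (A := Matrix (Fin 2) (Fin 2) F)).toLinearEquiv.finrank_eq

lemma finrank_iff_good (A : Fin m → Matrix (Fin 2) (Fin 2) F) :
    Module.finrank F (Algebra.adjoin F (Set.range A)) = 4 ↔
    GoodT (fun i => A i 0 0 - A i 1 1) (fun i => A i 0 1) (fun i => A i 1 0) := by
  rw [top_iff_finrank]
  exact ⟨good_of_top A, top_of_good A⟩

def tupEquiv : {A : Fin m → Matrix (Fin 2) (Fin 2) F //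
      GoodT (fun i => A i 0 0 - A i 1 1) (fun i => A i 0 1) (fun i => A i 1 0)} ≃
    (Fin m → F) × {t : (Fin m → F) × (Fin m → F) × (Fin m → F) // GoodT t.1 t.2.1 t.2.2} where
  toFun A := (fun i => A.1 i 1 1, ⟨(fun i => A.1 i 0 0 - A.1 i 1 1, fun i => A.1 i 0 1, fun i => A.1 i 1 0), A.2⟩)
  invFun t := ⟨fun i => !![t.2.1.1 i + t.1 i, t.2.1.2.1 i; t.2.1.2.2 i, t.1 i], by simpa using t.2.2⟩
  left_inv A := by
    ext i j k; fin_cases j <;> fin_cases k <;> simp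
  right_inv t := by
    simp

abbrev LI (F : Type*) [Field F] (m : ℕ) := {s : Fin 2 → (Fin m → F) // LinearIndependent F s}

lemma li_eta (s : LI F m) : LinearIndependent F ![s.1 0, s.1 1] := by
  have : ![s.1 0, s.1 1] = s.1 := by ext i; fin_cases i <;> rfl
  rw [this]; exact s.2

abbrev Bad1 (F : Type*) [Field F] (m : ℕ) := {t : LI F m × (Fin m → F) //
  ∃ l : Fˣ, t.2 = (l : F) • t.1.1 0 - ((l⁻¹ : Fˣ) : F) • t.1.1 1}

lemma card_bad1 : Nat.card (Bad1 F m) = Nat.card (LI F m × Fˣ) := by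
  symm
  refine Nat.card_congr (Equiv.ofBijective
    (fun p : LI F m × Fˣ => (⟨(p.1, (p.2 : F) • p.1.1 0 - ((p.2⁻¹ : Fˣ) : F) • p.1.1 1), p.2, rfl⟩ : Bad1 F m)) ⟨?_, ?_⟩)
  · rintro ⟨s, l⟩ ⟨s', l'⟩ h
    simp only [Subtype.mk.injEq, Prod.mk.injEq] at h
    obtain ⟨rfl, h⟩ := h
    have := LinearIndependent.pair_iff.1 (li_eta s) ((l : F) - l') (((l'⁻¹ : Fˣ) : F) - ((l⁻¹ : Fˣ) : F))
      (by rw [← sub_eq_zero] at h; rw [← h]; module)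
    simp only [Prod.mk.injEq, true_and]
    exact Units.ext (sub_eq_zero.1 this.1)
  · rintro ⟨⟨s, a⟩, l, hl⟩
    exact ⟨(s, l), by simpa using hl.symm⟩

abbrev S1 (F : Type*) [Field F] (m : ℕ) :=
  {t : (Fin m → F) × (Fin m → F) × (Fin m → F) // LinearIndependent F ![t.2.1, t.2.2] ∧
    ¬ ∃ l : Fˣ, t.1 = (l : F) • t.2.1 - ((l⁻¹ : Fˣ) : F) • t.2.2}
abbrev S2 (F : Type*) [Field F] (m : ℕ) :=
  {t : (Fin m → F) × (Fin m → F) × (Fin m → F) // LinearIndependent F ![t.2.1, t.1] ∧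
    ∃ l : Fˣ, t.2.2 = (l : F) • t.2.1}

lemma card_S1 : Nat.card (S1 F m) = Nat.card {t : LI F m × (Fin m → F) //
  ¬ ∃ l : Fˣ, t.2 = (l : F) • t.1.1 0 - ((l⁻¹ : Fˣ) : F) • t.1.1 1} := by
  refine Nat.card_congr
    { toFun := fun t => ⟨(⟨![t.1.2.1, t.1.2.2], t.2.1⟩, t.1.1), by simpa using t.2.2⟩
      invFun := fun t => ⟨(t.1.2, t.1.1.1 0, t.1.1.1 1), li_eta _, t.2⟩
      left_inv := fun t => by simp
      right_inv := fun t => ?_ }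
  ext i j
  · fin_cases i <;> simp
  · simp

lemma card_S2 : Nat.card (S2 F m) = Nat.card (LI F m × Fˣ) := by
  symm
  refine Nat.card_congr (Equiv.ofBijective
    (fun p : LI F m × Fˣ => (⟨(p.1.1 1, p.1.1 0, (p.2 : F) • p.1.1 0), li_eta _, p.2, rfl⟩ : S2 F m)) ⟨?_, ?_⟩)
  · rintro ⟨s, l⟩ ⟨s', l'⟩ h
    simp only [Subtype.mk.injEq, Prod.mk.injEq] at h
    obtain ⟨h1, h0, h⟩ := h
    have hs : s = s' := by
      apply Subtype.ext; funext i; fin_cases i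
      · exact h0
      · exact h1
    subst hs
    have hne : s.1 0 ≠ 0 := s.2.ne_zero 0
    simp only [Prod.mk.injEq, true_and]
    exact Units.ext (smul_left_injective F hne h)
  · rintro ⟨⟨a, b, c⟩, hi, l, hl⟩
    exact ⟨(⟨![b, a], hi⟩, l), by simpa using hl.symm⟩

lemma card_good [Fintype F] : Nat.card {t : (Fin m → F) × (Fin m → F) × (Fin m → F) //
    GoodT t.1 t.2.1 t.2.2} = Nat.card (LI F m) * Nat.card (Fin m → F) := by
  classical
  have e1 : Nat.card {t : (Fin m → F) × (Fin m → F) × (Fin m → F) // GoodT t.1 t.2.1 t.2.2}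
      = Nat.card (S1 F m) + Nat.card (S2 F m) := by
    rw [← Nat.card_sum]
    refine Nat.card_congr (Equiv.trans (Equiv.refl _) (subtypeOrEquiv _ _ ?_))
    rw [Pi.disjoint_iff]
    intro t
    rw [Prop.disjoint_iff]
    by_contra! hh
    obtain ⟨⟨hi, -⟩, -, l, hl⟩ := hh
    have := LinearIndependent.pair_iff.1 hi (l : F) (-1) (by rw [hl]; simp)
    simp at this
  rw [e1, card_S2, card_S1, ← card_bad1, add_comm, ← Nat.card_sum, ← Nat.card_prod]
  exact Nat.card_congr (Equiv.sumCompl _)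

abbrev Tup (F : Type*) [Field F] (m : ℕ) := {A : Fin m → Matrix (Fin 2) (Fin 2) F //
          Module.finrank F
            (Algebra.adjoin F (Set.range A) : Subalgebra F (Matrix (Fin 2) (Fin 2) F)) = 4}

lemma card_tup [Fintype F] (hm : 2 ≤ m) (q : ℕ) (hq : Fintype.card F = q) :
    Nat.card (Tup F m) = q ^ m * ((q ^ m - 1) * (q ^ m - q) * q ^ m) := by
  rw [Nat.card_congr ((Equiv.subtypeEquivRight finrank_iff_good).trans tupEquiv), Nat.card_prod,
    card_good, card_linearIndependent (by simpa using hm)]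
  simp [Fin.prod_univ_two, hq]

lemma mem_conj (P : GL (Fin 2) F) (A : Fin m → Matrix (Fin 2) (Fin 2) F)
    (hA : Algebra.adjoin F (Set.range A) = ⊤) :
    Algebra.adjoin F (Set.range (fun i => (P : Matrix (Fin 2) (Fin 2) F) * A i *
            ((P⁻¹ : GL (Fin 2) F) : Matrix (Fin 2) (Fin 2) F))) = ⊤ := by
  rw [eq_top_iff]
  rintro X -
  have key := adj_of_closed A (fun X => (P : Matrix (Fin 2) (Fin 2) F) * X *
            ((P⁻¹ : GL (Fin 2) F) : Matrix (Fin 2) (Fin 2) F) ∈ Algebra.adjoin F (Set.range (fun i => (P : Matrix (Fin 2) (Fin 2) F) * A i *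
            ((P⁻¹ : GL (Fin 2) F) : Matrix (Fin 2) (Fin 2) F)))) 
    (fun i => Algebra.subset_adjoin ⟨i, rfl⟩) ?_ ?_ ?_ hA (((P⁻¹ : GL (Fin 2) F) : Matrix (Fin 2) (Fin 2) F) * X * P)
  · have h : (P : Matrix (Fin 2) (Fin 2) F) * (((P⁻¹ : GL (Fin 2) F) : Matrix (Fin 2) (Fin 2) F) * X * P) * ((P⁻¹ : GL (Fin 2) F) : Matrix (Fin 2) (Fin 2) F) = X := by
      rw [Matrix.mul_assoc, Matrix.mul_assoc (_ * X), Units.mul_inv, Matrix.mul_one, ← Matrix.mul_assoc, Units.mul_inv, Matrix.one_mul]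
    rwa [h] at key
  · intro r
    have h : (!![r, 0; 0, r] : Matrix (Fin 2) (Fin 2) F) = r • 1 := by
      ext i j; fin_cases i <;> fin_cases j <;> simp
    rw [h, Matrix.mul_smul, Matrix.smul_mul, Matrix.mul_one, Units.mul_inv]
    exact Subalgebra.smul_mem _ (one_mem _) r
  · intro X Y hX hY
    rw [Matrix.mul_add, Matrix.add_mul]
    exact add_mem hX hY
  · intro X Y hX hY
    have := mul_mem hX hY
    convert this using 1
    simp only [Matrix.mul_assoc]
    rw [← Matrix.mul_assoc ((P⁻¹ : GL (Fin 2) F) : Matrix (Fin 2) (Fin 2) F) (P : Matrix (Fin 2) (Fin 2) F), Units.inv_mul, Matrix.one_mul]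

instance tupAct : MulAction (GL (Fin 2) F) (Tup F m) where
  smul P A := ⟨fun i => (P : Matrix (Fin 2) (Fin 2) F) * A.1 i *
            ((P⁻¹ : GL (Fin 2) F) : Matrix (Fin 2) (Fin 2) F), by
      rw [top_iff_finrank]
      exact mem_conj P A.1 ((top_iff_finrank _).1 A.2)⟩
  one_smul A := by
    apply Subtype.ext; funext i
    change ((1 : GL (Fin 2) F) : Matrix (Fin 2) (Fin 2) F) * A.1 i * ((1⁻¹ : GL (Fin 2) F) : Matrix (Fin 2) (Fin 2) F) = A.1 i
    simp
  mul_smul P Q A := by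
    apply Subtype.ext; funext i
    change ((P * Q : GL (Fin 2) F) : Matrix (Fin 2) (Fin 2) F) * A.1 i * (((P * Q)⁻¹ : GL (Fin 2) F) : Matrix (Fin 2) (Fin 2) F) =
      (P : Matrix (Fin 2) (Fin 2) F) * ((Q : Matrix (Fin 2) (Fin 2) F) * A.1 i * ((Q⁻¹ : GL (Fin 2) F) : Matrix (Fin 2) (Fin 2) F)) * ((P⁻¹ : GL (Fin 2) F) : Matrix (Fin 2) (Fin 2) F)
    rw [_root_.mul_inv_rev, Units.val_mul, Units.val_mul]
    simp only [Matrix.mul_assoc]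

lemma tup_smul_val (P : GL (Fin 2) F) (A : Tup F m) (i : Fin m) :
    (P • A).1 i = (P : Matrix (Fin 2) (Fin 2) F) * A.1 i *
            ((P⁻¹ : GL (Fin 2) F) : Matrix (Fin 2) (Fin 2) F) := rfl

lemma fixed_iff (P : GL (Fin 2) F) (A : Tup F m) :
    P • A = A ↔ P ∈ Subgroup.center (GL (Fin 2) F) := by
  have h1 : P • A = A ↔ ∀ i, (P : Matrix (Fin 2) (Fin 2) F) * A.1 i = A.1 i * P := by
    rw [Subtype.ext_iff, funext_iff]
    refine forall_congr' fun i => ?_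
    rw [tup_smul_val]
    exact Units.mul_inv_eq_iff_eq_mul P
  rw [h1]
  constructor
  · intro h
    rw [Subgroup.mem_center_iff]
    intro Q
    apply Units.ext
    rw [Units.val_mul, Units.val_mul]
    refine (adj_of_closed A.1 (fun X => (P : Matrix (Fin 2) (Fin 2) F) * X = X * P) h ?_ ?_ ?_
      ((top_iff_finrank _).1 A.2) (Q : Matrix (Fin 2) (Fin 2) F)).symm
    · intro r
      have h : (!![r, 0; 0, r] : Matrix (Fin 2) (Fin 2) F) = r • 1 := by
        ext i j; fin_cases i <;> fin_cases j <;> simp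
      rw [h]; simp
    · intro X Y hX hY; rw [Matrix.mul_add, Matrix.add_mul, hX, hY]
    · intro X Y hX hY; rw [← Matrix.mul_assoc, hX, Matrix.mul_assoc, hY, Matrix.mul_assoc]
  · intro h i
    obtain ⟨r, hr⟩ := Matrix.GeneralLinearGroup.mem_center_iff_val_mem_range_scalar.1 h
    rw [← hr]
    exact (Matrix.scalar_commute r (fun _ => Commute.all _ _) _)

lemma card_center [Fintype F] : Nat.card (Subgroup.center (GL (Fin 2) F)) = Fintype.card F - 1 := by
  classical
  rw [Matrix.GeneralLinearGroup.center_eq_range_scalar]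
  have hinj : Function.Injective (Matrix.GeneralLinearGroup.scalar (Fin 2) : Fˣ →* GL (Fin 2) F) := by
    intro a b h
    have := congrArg (fun P : GL (Fin 2) F => (P : Matrix (Fin 2) (Fin 2) F) 0 0) h
    apply Units.ext
    simpa using this
  rw [← Nat.card_congr (MonoidHom.ofInjective hinj).toEquiv, Nat.card_eq_fintype_card, Fintype.card_units]

lemma burnside [Fintype F] :
    Nat.card (Tup F m) * (Fintype.card F - 1) =
    Nat.card (Quotient (MulAction.orbitRel (GL (Fin 2) F) (Tup F m))) * Nat.card (GL (Fin 2) F) := by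
  rw [← Nat.card_prod, ← Nat.card_congr (MulAction.sigmaFixedByEquivOrbitsProdGroup (GL (Fin 2) F) (Tup F m)),
    ← card_center, ← Nat.card_prod]
  refine Nat.card_congr
    { toFun := fun p => ⟨p.2.1, p.1, (fixed_iff _ _).2 p.2.2⟩
      invFun := fun p => (p.2.1, ⟨p.1, (fixed_iff _ _).1 p.2.2⟩)
      left_inv := fun p => rfl
      right_inv := fun p => rfl }

end Aux

theorem stmt_14 (Fq : Type*) [Field Fq] [Fintype Fq] (q m : ℕ) (hm : 1 ≤ m)
    (hq : Fintype.card Fq = q) :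
    Nat.card (Quot (fun A B : {A : Fin m → Matrix (Fin 2) (Fin 2) Fq //
          Module.finrank Fq
            (Algebra.adjoin Fq (Set.range A) : Subalgebra Fq (Matrix (Fin 2) (Fin 2) Fq)) = 4} =>
        ∃ P : GL (Fin 2) Fq, ∀ i, (B : Fin m → Matrix (Fin 2) (Fin 2) Fq) i =
          (P : Matrix (Fin 2) (Fin 2) Fq) * (A : Fin m → Matrix (Fin 2) (Fin 2) Fq) i *
            ((P⁻¹ : GL (Fin 2) Fq) : Matrix (Fin 2) (Fin 2) Fq)))
      = q ^ (2 * m) * (q ^ m - 1) * (q ^ (m - 1) - 1) / (q ^ 2 - 1) := by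
  have hq2 : 2 ≤ q := by rw [← hq]; exact Fintype.one_lt_card
  have e : Nat.card (Quot (fun A B : Tup Fq m =>
        ∃ P : GL (Fin 2) Fq, ∀ i, (B : Fin m → Matrix (Fin 2) (Fin 2) Fq) i =
          (P : Matrix (Fin 2) (Fin 2) Fq) * (A : Fin m → Matrix (Fin 2) (Fin 2) Fq) i *
            ((P⁻¹ : GL (Fin 2) Fq) : Matrix (Fin 2) (Fin 2) Fq))) =
      Nat.card (Quotient (MulAction.orbitRel (GL (Fin 2) Fq) (Tup Fq m))) := by
    refine Nat.card_congr (Quot.congr (Equiv.refl _) ?_)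
    intro A B
    have : (MulAction.orbitRel (GL (Fin 2) Fq) (Tup Fq m)) A B ↔
        (MulAction.orbitRel (GL (Fin 2) Fq) (Tup Fq m)) B A := ⟨fun h => Setoid.symm' _ h, fun h => Setoid.symm' _ h⟩
    refine Iff.trans ?_ this.symm
    rw [MulAction.orbitRel_apply, MulAction.mem_orbit_iff]
    refine exists_congr fun P => ?_
    rw [eq_comm (a := P • A), Subtype.ext_iff, funext_iff]
    rfl
  refine e.trans ?_
  have hB := burnside (F := Fq) (m := m)
  rw [Matrix.card_GL_field, hq] at hB
  simp only [Fin.prod_univ_two, Fin.val_zero, Fin.val_one, pow_zero, pow_one] at hB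
  generalize Nat.card (Quotient (MulAction.orbitRel (GL (Fin 2) Fq) (Tup Fq m))) = N at hB
  obtain ⟨r, rfl⟩ : ∃ r, q = r + 2 := ⟨q - 2, by omega⟩
  have hpos : 0 < ((r + 2) ^ 2 - 1) := by
    have : 4 ≤ (r + 2) ^ 2 := by nlinarith
    omega
  have hpos2 : (r + 2) ^ 2 - (r + 2) = (r + 2) * (r + 1) := by
    rw [Nat.sub_eq_iff_eq_add (by nlinarith)]; ring
  rw [hpos2, show r + 2 - 1 = r + 1 by omega] at hB
  have hc : 0 < (r + 2) * (r + 1) := by positivity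
  symm
  apply Nat.div_eq_of_eq_mul_left hpos
  apply Nat.eq_of_mul_eq_mul_right hc
  rw [mul_assoc N, ← hB]
  obtain ⟨k, rfl⟩ : ∃ k, m = k + 1 := ⟨m - 1, by omega⟩
  rcases Nat.eq_zero_or_pos k with rfl | hk
  · have hz : Nat.card (Tup Fq 1) = 0 := by
      rw [Nat.card_congr (Equiv.subtypeEquivRight finrank_iff_good)]
      rw [Nat.card_eq_zero]; left
      constructor
      rintro ⟨A, hA⟩
      have : ∃ s : Fin 2 → (Fin 1 → Fq), LinearIndependent Fq s := by
        rcases hA with h | h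
        · exact ⟨_, h.1⟩
        · exact ⟨_, h.1⟩
      obtain ⟨s, hs⟩ := this
      have := hs.fintype_card_le_finrank
      simp at this
    change _ = Nat.card (Tup Fq 1) * _
    rw [hz]; simp
  · rw [card_tup (by omega) _ hq]
    have : (r + 2) ^ (k + 1) - (r + 2) = (r + 2) * ((r + 2) ^ k - 1) := by
      rw [Nat.mul_sub, pow_succ, mul_one, mul_comm]
    rw [this, Nat.add_sub_cancel]
    ring
end

section
/- The set of m-tuples (A_1,...,A_m) in M_2(F_q)^m with dim F_q⟨A_1,...,A_m⟩ = 2 and all A_i having equal eigenvalues (the unipotent stratum together with its Frobenius count) and the semisimple stratum together give |Rep_2(m)_{rk 2}(F_q)| = q^m(q^2 + q + 1)(q^m - 1); equivalently Rep_2(m)_{rk 2} decomposes as the disjoint union U_1 ⊔ ... ⊔ U_m where U_i consists of tuples with A_1,...,A_{i-1} scalar and A_i non-scalar, and |U_i| = q^{i-1}(q^4 - q)q^{2(m-i)}, summing to q^m(q^2+q+1)(q^m-1). -/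
open Matrix in
theorem aux_mem (F : Type*) [Field F] (N B : Matrix (Fin 2) (Fin 2) F) :
    B ∈ Algebra.adjoin F {N} ↔ B ∈ Submodule.span F (Set.range ![1, N]) := by
  have hspan : ∀ B, B ∈ Submodule.span F (Set.range ![1, N]) ↔ ∃ a b : F, a • 1 + b • N = B := by
    intro B
    simp [Matrix.range_cons, Submodule.mem_span_insert, Submodule.mem_span_singleton]
    constructor
    · rintro ⟨a, b, rfl⟩; exact ⟨b, a, add_comm _ _⟩
    · rintro ⟨a, b, rfl⟩; exact ⟨b, a, add_comm _ _⟩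
  constructor
  · intro h
    induction h using Algebra.adjoin_induction with
    | mem x hx =>
      rw [Set.mem_singleton_iff] at hx
      subst hx
      exact Submodule.subset_span ⟨1, rfl⟩
    | algebraMap r =>
      rw [hspan]; exact ⟨r, 0, by simp [Algebra.algebraMap_eq_smul_one]⟩
    | add x y _ _ hx hy => exact add_mem hx hy
    | mul x y _ _ hx hy =>
      rw [hspan] at *
      obtain ⟨a, b, rfl⟩ := hx
      obtain ⟨c, d, rfl⟩ := hy
      refine ⟨a * c - b * d * (N 0 0 * N 1 1 - N 0 1 * N 1 0),
        a * d + b * c + b * d * (N 0 0 + N 1 1), ?_⟩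
      ext i j
      fin_cases i <;> fin_cases j <;> simp [Matrix.mul_apply, Fin.sum_univ_two] <;> ring
  · rw [hspan]
    rintro ⟨a, b, rfl⟩
    exact add_mem (Subalgebra.smul_mem _ (one_mem _) _)
      (Subalgebra.smul_mem _ (Algebra.self_mem_adjoin_singleton F N) _)

theorem aux_finrank (F : Type*) [Field F] (N : Matrix (Fin 2) (Fin 2) F)
    (hN : ¬ ∃ c : F, N = c • (1 : Matrix (Fin 2) (Fin 2) F)) :
    Module.finrank F (Algebra.adjoin F {N} : Subalgebra F (Matrix (Fin 2) (Fin 2) F)) = 2 := by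
  have h1 : Subalgebra.toSubmodule (Algebra.adjoin F {N}) =
      Submodule.span F (Set.range ![1, N]) := by
    ext B
    exact aux_mem F N B
  have hli : LinearIndependent F ![1, N] := by
    rw [LinearIndependent.pair_iff' one_ne_zero]
    intro a h
    exact hN ⟨a, h.symm⟩
  have := finrank_span_eq_card hli
  rw [← h1] at this
  simpa using this

theorem aux_iff (F : Type*) [Field F] (m : ℕ) (A : Fin m → Matrix (Fin 2) (Fin 2) F) (i : Fin m)
    (hN : ¬ ∃ c : F, A i = c • (1 : Matrix (Fin 2) (Fin 2) F)) :
    Module.finrank F (Algebra.adjoin F (Set.range A) :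
      Subalgebra F (Matrix (Fin 2) (Fin 2) F)) = 2 ↔
    ∀ j, A j ∈ Algebra.adjoin F {A i} := by
  have hle : Algebra.adjoin F {A i} ≤ Algebra.adjoin F (Set.range A) :=
    Algebra.adjoin_mono (by simp)
  constructor
  · intro h j
    have : Subalgebra.toSubmodule (Algebra.adjoin F {A i}) =
        Subalgebra.toSubmodule (Algebra.adjoin F (Set.range A)) := by
      apply Submodule.eq_of_le_of_finrank_eq hle
      exact (aux_finrank F _ hN).trans h.symm
    replace this := Subalgebra.toSubmodule_injective this
    rw [this]
    exact Algebra.subset_adjoin ⟨j, rfl⟩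
  · intro h
    have : Algebra.adjoin F (Set.range A) = Algebra.adjoin F {A i} := by
      apply le_antisymm _ hle
      apply Algebra.adjoin_le
      rintro _ ⟨j, rfl⟩
      exact h j
    rw [this]
    exact aux_finrank F _ hN

theorem aux_scalar (F : Type*) [Field F] [Fintype F] :
    Nat.card {B : Matrix (Fin 2) (Fin 2) F // ∃ c : F, B = c • (1 : Matrix (Fin 2) (Fin 2) F)}
      = Fintype.card F := by
  rw [← Nat.card_eq_fintype_card]
  symm
  apply Nat.card_congr
  refine Equiv.ofBijective (fun c => ⟨c • 1, c, rfl⟩) ⟨?_, ?_⟩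
  · intro a b h
    have := congrFun (congrFun (congrArg Subtype.val h) 0) 0
    simpa using this
  · rintro ⟨_, c, rfl⟩
    exact ⟨c, rfl⟩

theorem aux_nonscalar (F : Type*) [Field F] [Fintype F] :
    Nat.card {B : Matrix (Fin 2) (Fin 2) F // ¬ ∃ c : F, B = c • (1 : Matrix (Fin 2) (Fin 2) F)}
      = Fintype.card F ^ 4 - Fintype.card F := by
  classical
  have h := aux_scalar F
  rw [Nat.card_eq_fintype_card] at h ⊢
  rw [Fintype.card_subtype_compl, h]
  congr 1
  have := Module.card_eq_pow_finrank (K := F) (V := Matrix (Fin 2) (Fin 2) F)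
  rw [this, Module.finrank_matrix]
  simp

def auxCond (F : Type*) [Field F] (m : ℕ) (i : Fin m) (N : Matrix (Fin 2) (Fin 2) F) (j : Fin m)
    (B : Matrix (Fin 2) (Fin 2) F) : Prop :=
  if j < i then ∃ c : F, B = c • (1 : Matrix (Fin 2) (Fin 2) F) else
    if j = i then B = N else B ∈ Algebra.adjoin F {N}

theorem aux_condcard (F : Type*) [Field F] [Fintype F] (m : ℕ) (i : Fin m)
    (N : Matrix (Fin 2) (Fin 2) F)
    (hN : ¬ ∃ c : F, N = c • (1 : Matrix (Fin 2) (Fin 2) F)) (j : Fin m) :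
    Nat.card {B // auxCond F m i N j B} =
      if j < i then Fintype.card F else if j = i then 1 else Fintype.card F ^ 2 := by
  unfold auxCond
  split_ifs
  · exact aux_scalar F
  · simp
  · have := Module.natCard_eq_pow_finrank (K := F) (V := Algebra.adjoin F {N})
    rw [aux_finrank F N hN, Nat.card_eq_fintype_card (α := F)] at this
    exact this

theorem aux_prod (m q : ℕ) (i : Fin m) :
    ∏ j : Fin m, (if j < i then q else if j = i then 1 else q ^ 2) =
      q ^ (i : ℕ) * q ^ (2 * (m - 1 - (i : ℕ))) := by
  have h : ∀ j : Fin m, (if j < i then q else if j = i then 1 else q ^ 2) =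
      (if j < i then q else 1) * (if i < j then q ^ 2 else 1) := by
    intro j
    rcases lt_trichotomy j i with h | h | h
    · simp [h, h.not_gt]
    · simp [h]
    · simp [h, h.not_gt, h.ne']
  simp_rw [h]
  rw [Finset.prod_mul_distrib]
  simp [Finset.prod_ite, pow_mul]
  congr 2
  · rw [← Fin.card_Iio]; congr 1; ext; simp
  · rw [← Fin.card_Ioi]; congr 1; ext; simp

theorem aux_U (F : Type*) [Field F] [Fintype F] (m : ℕ) (i : Fin m) :
    Nat.card {A : Fin m → Matrix (Fin 2) (Fin 2) F //
          Module.finrank F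
            (Algebra.adjoin F (Set.range A) : Subalgebra F (Matrix (Fin 2) (Fin 2) F)) = 2 ∧
          (∀ j, j < i → ∃ c : F, A j = c • (1 : Matrix (Fin 2) (Fin 2) F)) ∧
          ¬ ∃ c : F, A i = c • (1 : Matrix (Fin 2) (Fin 2) F)}
        = Fintype.card F ^ (i : ℕ) * (Fintype.card F ^ 4 - Fintype.card F) *
          Fintype.card F ^ (2 * (m - 1 - (i : ℕ))) := by
  classical
  let T := Σ N : {B : Matrix (Fin 2) (Fin 2) F //
      ¬ ∃ c : F, B = c • (1 : Matrix (Fin 2) (Fin 2) F)},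
      ∀ j, {B // auxCond F m i N.1 j B}
  have hT : Nat.card T = Fintype.card F ^ (i : ℕ) * (Fintype.card F ^ 4 - Fintype.card F) *
          Fintype.card F ^ (2 * (m - 1 - (i : ℕ))) := by
    have : ∀ N : {B : Matrix (Fin 2) (Fin 2) F //
      ¬ ∃ c : F, B = c • (1 : Matrix (Fin 2) (Fin 2) F)},
      Nat.card (∀ j, {B // auxCond F m i N.1 j B}) =
        Fintype.card F ^ (i : ℕ) * Fintype.card F ^ (2 * (m - 1 - (i : ℕ))) := by
      intro N
      rw [Nat.card_pi, ← aux_prod]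
      exact Finset.prod_congr rfl fun j _ => aux_condcard F m i N.1 N.2 j
    rw [Nat.card_sigma]
    simp_rw [this]
    rw [Finset.sum_const, Finset.card_univ, ← Nat.card_eq_fintype_card, aux_nonscalar]
    rw [smul_eq_mul]; ring
  rw [← hT]
  symm
  have hi : ∀ t : T, (t.2 i).1 = t.1.1 := by
    intro t
    have := (t.2 i).2
    simpa [auxCond] using this
  have hs : ∀ t : T, ∀ j, j < i → ∃ c : F, (t.2 j).1 = c • (1 : Matrix (Fin 2) (Fin 2) F) := by
    intro t j hj
    have := (t.2 j).2
    simpa only [auxCond, if_pos hj] using this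
  apply Nat.card_congr
  refine Equiv.ofBijective (fun t => ⟨fun j => (t.2 j).1, ?_, hs t, ?_⟩) ⟨?_, ?_⟩
  · rw [aux_iff F m _ i (by rw [hi]; exact t.1.2)]
    intro j
    rcases lt_trichotomy j i with h | h | h
    · obtain ⟨c, hc⟩ := hs t j h
      rw [hc]
      exact Subalgebra.smul_mem _ (one_mem _) _
    · rw [h]; exact Algebra.self_mem_adjoin_singleton F _
    · have := (t.2 j).2
      rw [hi]
      simpa only [auxCond, if_neg h.not_gt, if_neg h.ne'] using this
  · beta_reduce; rw [hi]; exact t.1.2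
  · intro s t hst
    have h : ∀ j, (s.2 j).1 = (t.2 j).1 := fun j => congrFun (congrArg Subtype.val hst) j
    have h1 : s.1 = t.1 := by
      apply Subtype.ext
      rw [← hi s, ← hi t, h]
    obtain ⟨a, f⟩ := s
    obtain ⟨b, g⟩ := t
    dsimp only at h1
    subst h1
    congr 1
    funext j
    exact Subtype.ext (h j)
  · rintro ⟨A, h1, h2, h3⟩
    refine ⟨⟨⟨A i, h3⟩, fun j => ⟨A j, ?_⟩⟩, rfl⟩
    unfold auxCond
    split_ifs with h h'
    · exact h2 j h
    · rw [h']
    · exact (aux_iff F m A i h3).1 h1 j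

theorem aux_sum (m q : ℕ) (hq : 1 < q) :
    ∑ i : Fin m, q ^ (i : ℕ) * (q ^ 4 - q) * q ^ (2 * (m - 1 - (i : ℕ))) =
      q ^ m * (q ^ 2 + q + 1) * (q ^ m - 1) := by
  rw [Fin.sum_univ_eq_sum_range (fun i => q ^ i * (q ^ 4 - q) * q ^ (2 * (m - 1 - i)))]
  have h4 : q ≤ q ^ 4 := Nat.le_self_pow (by norm_num) q
  have hm : 1 ≤ q ^ m := Nat.one_le_pow _ _ (by omega)
  zify [h4, hm]
  have := geom_sum₂_mul (q : ℤ) ((q : ℤ) ^ 2) m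
  have e : ∑ i ∈ Finset.range m, (q : ℤ) ^ i * ((q : ℤ) ^ 4 - q) * (q : ℤ) ^ (2 * (m - 1 - i)) =
    ((q : ℤ) ^ 4 - q) * ∑ i ∈ Finset.range m, (q : ℤ) ^ i * ((q : ℤ) ^ 2) ^ (m - 1 - i) := by
    rw [Finset.mul_sum]
    refine Finset.sum_congr rfl fun i _ => ?_
    rw [pow_mul]; ring
  rw [e]
  rw [← pow_mul, mul_comm 2 m, pow_mul] at this
  linear_combination (-((q : ℤ) ^ 2 + q + 1)) * this

/-- the stratum `Rep₂(m)_{rk 2}(F_q)` of `m`-tuples generating a 2-dimensional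
subalgebra of `M₂(F_q)` decomposes into the pieces `U_i` (first `i` matrices scalar, `A_i`
non-scalar) of cardinality `q^{i}(q⁴-q)q^{2(m-1-i)}` (zero-based `i`), and its total
cardinality is `q^m(q²+q+1)(q^m-1)`. -/
theorem stmt_17 (Fq : Type*) [Field Fq] [Fintype Fq] (q m : ℕ) (hq : Fintype.card Fq = q) :
    (∀ i : Fin m,
      Nat.card {A : Fin m → Matrix (Fin 2) (Fin 2) Fq //
          Module.finrank Fq
            (Algebra.adjoin Fq (Set.range A) : Subalgebra Fq (Matrix (Fin 2) (Fin 2) Fq)) = 2 ∧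
          (∀ j, j < i → ∃ c : Fq, A j = c • (1 : Matrix (Fin 2) (Fin 2) Fq)) ∧
          ¬ ∃ c : Fq, A i = c • (1 : Matrix (Fin 2) (Fin 2) Fq)}
        = q ^ (i : ℕ) * (q ^ 4 - q) * q ^ (2 * (m - 1 - (i : ℕ)))) ∧
    Nat.card {A : Fin m → Matrix (Fin 2) (Fin 2) Fq //
        Module.finrank Fq
          (Algebra.adjoin Fq (Set.range A) : Subalgebra Fq (Matrix (Fin 2) (Fin 2) Fq)) = 2}
      = q ^ m * (q ^ 2 + q + 1) * (q ^ m - 1) := by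
  subst hq
  refine ⟨fun i => aux_U Fq m i, ?_⟩
  rw [← aux_sum m _ Fintype.one_lt_card, ← Finset.sum_congr rfl fun i _ => aux_U Fq m i,
    ← Nat.card_sigma]
  symm
  apply Nat.card_congr
  refine Equiv.ofBijective (fun t => ⟨t.2.1, t.2.2.1⟩) ⟨?_, ?_⟩
  · rintro ⟨i, A, hA1, hA2, hA3⟩ ⟨j, B, hB1, hB2, hB3⟩ h
    have h : A = B := congrArg Subtype.val h
    subst h
    have : i = j := by
      rcases lt_trichotomy i j with h | h | h
      · exact absurd (hB2 i h) hA3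
      · exact h
      · exact absurd (hA2 j h) hB3
    subst this
    rfl
  · rintro ⟨A, hA⟩
    have hex : ∃ i, ¬ ∃ c : Fq, A i = c • (1 : Matrix (Fin 2) (Fin 2) Fq) := by
      by_contra hcon
      push Not at hcon
      have : Algebra.adjoin Fq (Set.range A) = ⊥ := by
        rw [eq_bot_iff]
        apply Algebra.adjoin_le
        rintro _ ⟨j, rfl⟩
        obtain ⟨c, hc⟩ := hcon j
        rw [hc]
        exact Subalgebra.smul_mem _ (one_mem _) _
      rw [this, Subalgebra.finrank_bot] at hA
      omega
    obtain ⟨i, hi, hmin⟩ := WellFounded.has_min (wellFounded_lt (α := Fin m))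
      {i | ¬ ∃ c : Fq, A i = c • (1 : Matrix (Fin 2) (Fin 2) Fq)} hex
    refine ⟨⟨i, A, hA, fun j hj => ?_, hi⟩, rfl⟩
    by_contra hc
    exact hmin j hc hj
end
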